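/- Let δ be a positive odd integer and let u : ℝ^n → ℝ be continuously differentiable and satisfy: (i) −∇u(x)·f(x,d) − δ·q(x)·(1 − u(x)) ≥ 0 for all x ∈ B̄ ∖ X∞ and all d ∈ D; (ii) u(x) + (1 − h_j(x))^δ − 1 ≥ 0 for all j = 1,…,n_X and all x ∈ closure(X) ∖ X∞; (iii) u(x) − 1 ≥ 0 for all x ∈ B̄ ∖ X. Set Ω := {x ∈ B̄ : u(x) < 1}. Then every trajectory starting in Ω reaches X∞ in finite time: for every x₀ ∈ Ω, every admissible input d, and every trajectory ψ of f from x₀ under d on [0,∞), there exists τ ≥ 0 such that ψ(τ) ∈ X∞. -/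

import Mathlib

open MeasureTheory Metric Set Filter Topology

open scoped ENNReal NNReal

attribute [local instance] Classical.propDecidable

noncomputable section

/-- Euclidean state space ℝ^n. -/
abbrev Eu (n : ℕ) : Type := EuclideanSpace ℝ (Fin n)

/-- An admissible perturbation input: a measurable function taking values in D. -/
def IsAdmissible {m : ℕ} (D : Set (Eu m)) (d : ℝ → Eu m) : Prop :=
  Measurable d ∧ ∀ t : ℝ, d t ∈ D

/-- ψ is a trajectory of ẋ = f(x, d(t)) from x₀ on the time set I (0 ∈ I). -/
def IsTrajOn {n m : ℕ} (f : Eu n → Eu m → Eu n) (x₀ : Eu n) (d : ℝ → Eu m)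
    (I : Set ℝ) (ψ : ℝ → Eu n) : Prop :=
  ContinuousOn ψ I ∧ ∀ t ∈ I, ψ t = x₀ + ∫ s in (0:ℝ)..t, f (ψ s) (d s)

/-- f : ℝ^n × ℝ^m → ℝ^n is a polynomial map. -/
def IsPolyMap {n m : ℕ} (f : Eu n → Eu m → Eu n) : Prop :=
  ∃ p : Fin n → MvPolynomial (Fin n ⊕ Fin m) ℝ,
    ∀ x d i, f x d i = MvPolynomial.eval (Sum.elim (fun j => x j) (fun j => d j)) (p i)

/-- q : ℝ^n → ℝ is a polynomial function. -/
def IsPolyFun {n : ℕ} (q : Eu n → ℝ) : Prop :=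
  ∃ p : MvPolynomial (Fin n) ℝ, ∀ x, q x = MvPolynomial.eval (fun j => x j) p

lemma IsPolyMap.continuous {n m : ℕ} {f : Eu n → Eu m → Eu n} (hf : IsPolyMap f) :
    Continuous fun p : Eu n × Eu m => f p.1 p.2 := by
  obtain ⟨P, hP⟩ := hf
  refine (PiLp.continuous_toLp 2 _).comp (continuous_pi fun i => ?_)
    |>.congr fun p => (WithLp.toLp_ofLp 2 (f p.1 p.2))
  simp only [hP]
  refine (MvPolynomial.continuous_eval (P i)).comp (continuous_pi fun j => ?_)
  cases j <;> simp only [Sum.elim_inl, Sum.elim_inr] <;> fun_prop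

lemma IsPolyFun.continuous {n : ℕ} {q : Eu n → ℝ} (hq : IsPolyFun q) : Continuous q := by
  obtain ⟨P, hP⟩ := hq
  rw [show q = fun x => MvPolynomial.eval (fun j => x j) P from funext hP]
  exact (MvPolynomial.continuous_eval P).comp (by fun_prop)

section Trajectory

variable {n m : ℕ} {f : Eu n → Eu m → Eu n} {D : Set (Eu m)} {d : ℝ → Eu m}
  {x₀ : Eu n} {ψ : ℝ → Eu n}

lemma IsTrajOn.apply_zero (hψ : IsTrajOn f x₀ d (Ici 0) ψ) : ψ 0 = x₀ := by
  simpa using hψ.2 0 self_mem_Ici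

lemma IsTrajOn.intervalIntegrable (hf : Continuous fun p : Eu n × Eu m => f p.1 p.2)
    (hD : IsCompact D) (hd : IsAdmissible D d) (hψ : IsTrajOn f x₀ d (Ici 0) ψ)
    {t : ℝ} (ht : 0 ≤ t) :
    IntervalIntegrable (fun s => f (ψ s) (d s)) volume 0 t := by
  have hcont : ContinuousOn ψ (Icc 0 t) := hψ.1.mono Icc_subset_Ici_self
  obtain ⟨C, hC⟩ := ((isCompact_Icc.image_of_continuousOn hcont).prod hD).exists_bound_of_continuousOn
    hf.continuousOn
  rw [intervalIntegrable_iff_integrableOn_Icc_of_le ht]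
  refine IntegrableOn.of_bound measure_Icc_lt_top ?_ C ?_
  · exact hf.comp_aestronglyMeasurable ((hcont.aestronglyMeasurable measurableSet_Icc).prodMk
      hd.1.aestronglyMeasurable)
  · filter_upwards [ae_restrict_mem measurableSet_Icc] with s hs
    exact hC (ψ s, d s) ⟨mem_image_of_mem ψ hs, hd.2 s⟩

lemma IsTrajOn.sub_eq_integral (hf : Continuous fun p : Eu n × Eu m => f p.1 p.2)
    (hD : IsCompact D) (hd : IsAdmissible D d) (hψ : IsTrajOn f x₀ d (Ici 0) ψ)
    {a b : ℝ} (ha : 0 ≤ a) (hb : 0 ≤ b) :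
    ψ b - ψ a = ∫ s in a..b, f (ψ s) (d s) := by
  rw [hψ.2 a ha, hψ.2 b hb, add_sub_add_left_eq_sub]
  exact intervalIntegral.integral_interval_sub_left
    (hψ.intervalIntegrable hf hD hd hb) (hψ.intervalIntegrable hf hD hd ha)

/-- If the Lie derivative of `u` at `ψ a` is at most `K` for every value of the input, then the
upper right Dini derivative of `u ∘ ψ` at `a` is at most `K`. -/
lemma IsTrajOn.eventually_slope_lt (hf : Continuous fun p : Eu n × Eu m => f p.1 p.2)
    (hD : IsCompact D) (hd : IsAdmissible D d) (hψ : IsTrajOn f x₀ d (Ici 0) ψ)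
    {u : Eu n → ℝ} {a K r : ℝ} (ha : 0 ≤ a) (hu : DifferentiableAt ℝ u (ψ a))
    (hK : ∀ e ∈ D, fderiv ℝ u (ψ a) (f (ψ a) e) ≤ K) (hr : K < r) :
    ∀ᶠ z in 𝓝[>] a, slope (u ∘ ψ) a z < r := by
  set L := fderiv ℝ u (ψ a)
  obtain ⟨C, hC⟩ := hD.exists_bound_of_continuousOn
    (f := fun e => f (ψ a) e) (by fun_prop)
  set M : ℝ := max C 0 + 1
  have hM : 0 < M := by positivity
  set ε : ℝ := (r - K) / (4 * M)
  have hε : 0 < ε := div_pos (sub_pos.2 hr) (by positivity)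
  have hεM : ε * M = (r - K) / 4 := by simp only [ε]; field_simp
  have hnear : ∀ᶠ w in 𝓝 (ψ a), ∀ e ∈ D, ‖f w e‖ < M ∧ L (f w e) < (K + r) / 2 := by
    refine hD.eventually_forall_of_forall_eventually fun e he => ?_
    have h1 : ‖f (ψ a) e‖ < M := (hC e he).trans_lt (by
      have := le_max_left C 0
      simp only [M]; linarith)
    have h2 : L (f (ψ a) e) < (K + r) / 2 := by linarith [hK e he]
    have hLf : Continuous fun p : Eu n × Eu m => L (f p.1 p.2) := L.continuous.comp hf
    have e1 : ∀ᶠ p in 𝓝 (ψ a, e), ‖f p.1 p.2‖ < M :=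
      hf.norm.continuousAt.tendsto.eventually_lt_const h1
    have e2 : ∀ᶠ p in 𝓝 (ψ a, e), L (f p.1 p.2) < (K + r) / 2 :=
      hLf.continuousAt.tendsto.eventually_lt_const h2
    exact e1.and e2
  have hlin : ∀ᶠ w in 𝓝 (ψ a), ‖u w - u (ψ a) - L (w - ψ a)‖ ≤ ε * ‖w - ψ a‖ :=
    hu.hasFDerivAt.isLittleO.bound hε
  have htend : Tendsto ψ (𝓝[≥] a) (𝓝 (ψ a)) :=
    (hψ.1 a ha).mono_left (nhdsWithin_mono _ (Ici_subset_Ici.2 ha))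
  obtain ⟨b, hab, hb⟩ := (mem_nhdsGE_iff_exists_Ico_subset).1
    (htend.eventually (hnear.and hlin))
  filter_upwards [Ioo_mem_nhdsGT hab] with z hz
  have haz : a < z := hz.1
  have hz0 : 0 ≤ z := ha.trans haz.le
  have hs : ∀ s ∈ Icc a z, ∀ e ∈ D, ‖f (ψ s) e‖ < M ∧ L (f (ψ s) e) < (K + r) / 2 :=
    fun s hs => (hb ⟨hs.1, hs.2.trans_lt hz.2⟩).1
  have hint : IntervalIntegrable (fun s => f (ψ s) (d s)) volume a z :=
    (hψ.intervalIntegrable hf hD hd ha).symm.trans (hψ.intervalIntegrable hf hD hd hz0)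
  have hsub := hψ.sub_eq_integral hf hD hd ha hz0
  have hnorm : ‖ψ z - ψ a‖ ≤ M * (z - a) := by
    rw [hsub, ← abs_of_pos (sub_pos.2 haz)]
    refine intervalIntegral.norm_integral_le_of_norm_le_const fun s hs' => ?_
    rw [uIoc_of_le haz.le] at hs'
    exact (hs s ⟨hs'.1.le, hs'.2⟩ _ (hd.2 s)).1.le
  have hL : L (ψ z - ψ a) ≤ (K + r) / 2 * (z - a) := by
    rw [hsub, ← L.intervalIntegral_comp_comm hint]
    calc ∫ s in a..z, L (f (ψ s) (d s)) ≤ ∫ _ in a..z, (K + r) / 2 :=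
          intervalIntegral.integral_mono_on haz.le ⟨L.integrable_comp hint.1, L.integrable_comp hint.2⟩
            intervalIntegrable_const fun s hs' => (hs s hs' _ (hd.2 s)).2.le
      _ = (K + r) / 2 * (z - a) := by
        rw [intervalIntegral.integral_const, smul_eq_mul, mul_comm]
  have hrem := (le_abs_self _).trans (hb ⟨haz.le, hz.2⟩).2
  have hεn : ε * ‖ψ z - ψ a‖ ≤ (r - K) / 4 * (z - a) := by
    calc ε * ‖ψ z - ψ a‖ ≤ ε * (M * (z - a)) := by gcongr
      _ = (r - K) / 4 * (z - a) := by rw [← mul_assoc, hεM]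
  rw [slope_def_field, div_lt_iff₀ (sub_pos.2 haz)]
  simp only [Function.comp_apply]
  nlinarith [mul_pos (sub_pos.2 hr) (sub_pos.2 haz)]

/-- If, along a trajectory, the Lie derivative of `u` is at most `-κ (1 - u)` with `κ ≥ c`
wherever `u < 1`, then `1 - u` grows at least linearly along it. -/
lemma IsTrajOn.le_linear (hf : Continuous fun p : Eu n × Eu m => f p.1 p.2)
    (hD : IsCompact D) (hd : IsAdmissible D d) (hψ : IsTrajOn f x₀ d (Ici 0) ψ)
    {u : Eu n → ℝ} (hu : ContDiff ℝ 1 u) {κ : Eu n → ℝ} {c T : ℝ} (hc : 0 < c)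
    (hx₀ : u x₀ < 1)
    (hdecay : ∀ t ∈ Ico 0 T, c ≤ κ (ψ t) ∧
      ∀ e ∈ D, fderiv ℝ u (ψ t) (f (ψ t) e) ≤ -(κ (ψ t) * (1 - u (ψ t)))) :
    ∀ t ∈ Icc 0 T, u (ψ t) ≤ u x₀ - c / 2 * (1 - u x₀) * t := by
  have hv : 0 < 1 - u x₀ := sub_pos.2 hx₀
  intro t ht
  refine image_le_of_liminf_slope_right_lt_deriv_boundary
    (f := u ∘ ψ) (f' := fun t => -(κ (ψ t) * (1 - u (ψ t))))
    (B := fun t => u x₀ - c / 2 * (1 - u x₀) * t) (B' := fun _ => -(c / 2 * (1 - u x₀)))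
    (hu.continuous.comp_continuousOn (hψ.1.mono Icc_subset_Ici_self)) ?_ ?_ ?_ ?_ ht
  · exact fun x hx r hr => (hψ.eventually_slope_lt hf hD hd hx.1
      (hu.differentiable one_ne_zero _) (hdecay x hx).2 hr).frequently
  · simp [hψ.apply_zero]
  · intro x
    simpa using ((hasDerivAt_id x).const_mul (c / 2 * (1 - u x₀))).const_sub (u x₀)
  · intro x hx hxeq
    have hge : 1 - u x₀ ≤ 1 - u (ψ x) := by
      have : 0 ≤ c / 2 * (1 - u x₀) * x := mul_nonneg (by positivity) hx.1
      simp only [Function.comp_apply] at hxeq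
      linarith
    have := mul_le_mul (hdecay x hx).1 hge hv.le (hc.le.trans (hdecay x hx).1)
    nlinarith [mul_pos hc hv]

end Trajectory

/-- Every trajectory starting in Ω = {x ∈ B̄ : u(x) < 1} reaches X∞ in finite time. -/
theorem statement_18
    {n m nX : ℕ} (hnX : 0 < nX)
    (f : Eu n → Eu m → Eu n) (hfpoly : IsPolyMap f)
    (D : Set (Eu m)) (hD : IsCompact D)
    (h : Fin nX → Eu n → ℝ) (hhpoly : ∀ j, IsPolyFun (h j))
    (hhnn : ∀ j x, 0 ≤ h j x) (hh0 : ∀ j, h j (0 : Eu n) = 0)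
    (X : Set (Eu n)) (hXdef : X = {x | ∀ j, h j x < 1})
    (hXbdd : Bornology.IsBounded X)
    (α : ℝ) (hα : 0 < α) (s : ℕ) (hs : 2 ≤ s)
    (q : Eu n → ℝ) (hqpoly : IsPolyFun q) (hqnn : ∀ x, 0 ≤ q x)
    (hq0 : q (0 : Eu n) = 0) (hqpos : ∀ x : Eu n, x ≠ 0 → 0 < q x)
    (Xinf : Set (Eu n)) (hXinfdef : Xinf = {x | q x < α})
    (hXinfbdd : Bornology.IsBounded Xinf)
    (Rad : ℝ) (hRad : 0 < Rad) (Bbar : Set (Eu n))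
    (hBbar : Bbar = Metric.closedBall (0 : Eu n) Rad)
    (hXB : closure X ⊆ Metric.ball (0 : Eu n) Rad)
    (h0Xinf : (0 : Eu n) ∈ Xinf) (hXinfX : closure Xinf ⊆ X)
    (hattr : ∀ x₀ ∈ Xinf, ∀ d, IsAdmissible D d →
      (∃ ψ', IsTrajOn f x₀ d (Ici 0) ψ') ∧
      ∀ ψ', IsTrajOn f x₀ d (Ici 0) ψ' →
        (∀ t : ℝ, 0 ≤ t → ψ' t ∈ X) ∧ Tendsto ψ' atTop (nhds (0 : Eu n)))
    (δ : ℕ) (hδodd : Odd δ) (hδpos : 0 < δ)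
    (u : Eu n → ℝ) (hu : ContDiff ℝ 1 u)
    (hc1 : ∀ x ∈ Bbar \ Xinf, ∀ d ∈ D,
      0 ≤ -(fderiv ℝ u x (f x d)) - (δ : ℝ) * q x * (1 - u x))
    (hc2 : ∀ j : Fin nX, ∀ x ∈ closure X \ Xinf, 0 ≤ u x + (1 - h j x) ^ δ - 1)
    (hc3 : ∀ x ∈ Bbar \ X, 0 ≤ u x - 1)
 :
    ∀ x₀ ∈ {x ∈ Bbar | u x < 1}, ∀ d, IsAdmissible D d →
      ∀ ψ', IsTrajOn f x₀ d (Ici 0) ψ' → ∃ τ : ℝ, 0 ≤ τ ∧ ψ' τ ∈ Xinf := by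
  rintro x₀ ⟨hx₀B, hx₀u⟩ d hd ψ hψ
  by_contra! hnot
  have hf := hfpoly.continuous
  have hXopen : IsOpen X := by
    rw [hXdef, ofPred_forall]
    exact isOpen_iInter_of_finite fun j => isOpen_lt (hhpoly j).continuous continuous_const
  have hXBbar : closure X ⊆ Bbar := hBbar ▸ hXB.trans ball_subset_closedBall
  have hδα : 0 < (δ : ℝ) * α := mul_pos (Nat.cast_pos.2 hδpos) hα
  have hbound : ∀ T : ℝ, (∀ t ∈ Ico 0 T, ψ t ∈ X) → ∀ t ∈ Icc 0 T,
      u (ψ t) ≤ u x₀ - δ * α / 2 * (1 - u x₀) * t := by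
    intro T hT
    refine hψ.le_linear hf hD hd hu (κ := fun x => δ * q x) hδα hx₀u fun t ht => ⟨?_, fun e he => ?_⟩
    · have : α ≤ q (ψ t) := by simpa [hXinfdef] using hnot t ht.1
      gcongr
    · linarith [hc1 (ψ t) ⟨hXBbar (subset_closure (hT t ht)), hnot t ht.1⟩ e he]
  have hstay : ∀ t, 0 ≤ t → ψ t ∈ X := by
    by_contra! hexit
    obtain ⟨T, hT0, hTX⟩ := hexit
    have hS : IsCompact (Icc 0 T ∩ ψ ⁻¹' Xᶜ) := isCompact_Icc.of_isClosed_subset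
      ((hψ.1.mono Icc_subset_Ici_self).preimage_isClosed_of_isClosed isClosed_Icc
        hXopen.isClosed_compl) inter_subset_left
    obtain ⟨t₁, ⟨ht₁, ht₁X⟩, hmin⟩ := hS.exists_isLeast ⟨T, ⟨hT0, le_rfl⟩, hTX⟩
    have hbefore : ∀ t ∈ Ico 0 t₁, ψ t ∈ X := fun t ht => by
      by_contra htX
      exact (hmin ⟨⟨ht.1, ht.2.le.trans ht₁.2⟩, htX⟩).not_gt ht.2
    have ht₁B : ψ t₁ ∈ Bbar := by
      rcases ht₁.1.eq_or_lt with h0 | hpos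
      · rwa [← h0, hψ.apply_zero]
      · refine hXBbar (((hψ.1 t₁ ht₁.1).mono Ico_subset_Ici_self).mem_closure
          (s := Ico 0 t₁) ?_ hbefore)
        rw [closure_Ico hpos.ne]
        exact ⟨hpos.le, le_rfl⟩
    have hle := hbound t₁ hbefore t₁ ⟨ht₁.1, le_rfl⟩
    have : 0 ≤ δ * α / 2 * (1 - u x₀) * t₁ :=
      mul_nonneg (mul_nonneg (by positivity) (sub_pos.2 hx₀u).le) ht₁.1
    linarith [hc3 (ψ t₁) ⟨ht₁B, ht₁X⟩]
  obtain ⟨C, hC⟩ := hXbdd.isCompact_closure.exists_bound_of_continuousOn hu.continuous.continuousOn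
  have hrate : 0 < δ * α / 2 * (1 - u x₀) := mul_pos (by positivity) (sub_pos.2 hx₀u)
  set T : ℝ := (|u x₀| + |C| + 1) / (δ * α / 2 * (1 - u x₀))
  have hT0 : 0 ≤ T := by positivity
  have hle := hbound T (fun t ht => hstay t ht.1) T ⟨hT0, le_rfl⟩
  rw [mul_div_cancel₀ _ hrate.ne'] at hle
  have hlow := (abs_le.1 (hC (ψ T) (subset_closure (hstay T hT0)))).1
  linarith [le_abs_self (u x₀), le_abs_self C]
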